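/- The set H₄ of matrices [[a,b],[c,d]] ∈ GL(2,ℤ) with a ≡ d ≡ 1 (mod 4) and b ≡ c ≡ 0 (mod 2) is a subgroup of GL(2,ℤ), and it is a normal subgroup of H₂, the subgroup of matrices congruent to the identity modulo 2. -/

import Mathlib

open Matrix

/-- The set `H₄` of matrices `[[a,b],[c,d]] ∈ GL(2,ℤ)` with `a ≡ d ≡ 1 (mod 4)`
and `b ≡ c ≡ 0 (mod 2)`. -/
def H₄set : Set (GL (Fin 2) ℤ) :=
  {A | (A : Matrix (Fin 2) (Fin 2) ℤ) 0 0 ≡ 1 [ZMOD 4] ∧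
       (A : Matrix (Fin 2) (Fin 2) ℤ) 1 1 ≡ 1 [ZMOD 4] ∧
       (A : Matrix (Fin 2) (Fin 2) ℤ) 0 1 ≡ 0 [ZMOD 2] ∧
       (A : Matrix (Fin 2) (Fin 2) ℤ) 1 0 ≡ 0 [ZMOD 2]}

theorem mem_H₄set_iff {A : GL (Fin 2) ℤ} :
    A ∈ H₄set ↔ ∃ a b c d : ℤ,
      (A : Matrix (Fin 2) (Fin 2) ℤ) = !![1 + 4 * a, 2 * b; 2 * c, 1 + 4 * d] := by
  constructor
  · rintro ⟨h₀₀, h₁₁, h₀₁, h₁₀⟩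
    obtain ⟨a, ha⟩ := h₀₀.symm.dvd
    obtain ⟨d, hd⟩ := h₁₁.symm.dvd
    obtain ⟨b, hb⟩ := h₀₁.symm.dvd
    obtain ⟨c, hc⟩ := h₁₀.symm.dvd
    refine ⟨a, b, c, d, ?_⟩
    ext i j
    fin_cases i <;> fin_cases j <;> simp <;> linarith
  · rintro ⟨a, b, c, d, h⟩
    simp [H₄set, h, Int.modEq_iff_dvd]

theorem det_mul_self_of_GL_int {n : Type*} [Fintype n] [DecidableEq n] (A : GL n ℤ) :
    (A : Matrix n n ℤ).det * (A : Matrix n n ℤ).det = 1 :=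
  Int.isUnit_mul_self ((Matrix.isUnit_iff_isUnit_det _).mp A.isUnit)

theorem coe_inv_GL_int {n : Type*} [Fintype n] [DecidableEq n] (A : GL n ℤ) :
    ((A⁻¹ : GL n ℤ) : Matrix n n ℤ) =
      (A : Matrix n n ℤ).det • (A : Matrix n n ℤ).adjugate := by
  apply Units.inv_eq_of_mul_eq_one_right
  rw [Matrix.mul_smul, Matrix.mul_adjugate, smul_smul, det_mul_self_of_GL_int, one_smul]

theorem det_eq_one_of_mem_H₄set {A : GL (Fin 2) ℤ} (hA : A ∈ H₄set) :
    (A : Matrix (Fin 2) (Fin 2) ℤ).det = 1 := by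
  obtain ⟨a, b, c, d, h⟩ := mem_H₄set_iff.mp hA
  have hdet : (A : Matrix (Fin 2) (Fin 2) ℤ).det = 1 + 4 * (a + d + 4 * (a * d) - b * c) := by
    rw [h, Matrix.det_fin_two_of]
    ring
  have := Int.isUnit_iff.mp ((Matrix.isUnit_iff_isUnit_det _).mp A.isUnit)
  omega

/-- `H₄` is a subgroup of `GL(2,ℤ)` (it contains the identity and is
closed under multiplication and inverses), and it is normal in `H₂`, the
subgroup of matrices congruent to the identity modulo 2. -/
theorem H4_subgroup_normal_in_H2 :
    (1 : GL (Fin 2) ℤ) ∈ H₄set ∧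
    (∀ A ∈ H₄set, ∀ B ∈ H₄set, A * B ∈ H₄set) ∧
    (∀ A ∈ H₄set, A⁻¹ ∈ H₄set) ∧
    (∀ G : GL (Fin 2) ℤ,
      (∀ i j, (G : Matrix (Fin 2) (Fin 2) ℤ) i j ≡
          (1 : Matrix (Fin 2) (Fin 2) ℤ) i j [ZMOD 2]) →
      ∀ A ∈ H₄set, G * A * G⁻¹ ∈ H₄set) := by
  refine ⟨?_, ?_, ?_, ?_⟩
  · simp [H₄set]
  · intro A hA B hB
    obtain ⟨a, b, c, d, hA⟩ := mem_H₄set_iff.mp hA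
    obtain ⟨a', b', c', d', hB⟩ := mem_H₄set_iff.mp hB
    refine mem_H₄set_iff.mpr ⟨a + a' + 4 * a * a' + b * c', b' + 4 * a * b' + b + 4 * b * d',
      c + 4 * c * a' + c' + 4 * d * c', d + d' + 4 * d * d' + c * b', ?_⟩
    rw [Units.val_mul, hA, hB, Matrix.mul_fin_two]
    congr! 3 <;> ring_nf
  · intro A hA
    have hdet := det_eq_one_of_mem_H₄set hA
    obtain ⟨a, b, c, d, h⟩ := mem_H₄set_iff.mp hA
    refine mem_H₄set_iff.mpr ⟨d, -b, -c, a, ?_⟩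
    rw [coe_inv_GL_int, hdet, one_smul, h, Matrix.adjugate_fin_two_of]
    simp
  · intro G hG A hA
    obtain ⟨a, b, c, d, hA⟩ := mem_H₄set_iff.mp hA
    obtain ⟨q, hq⟩ := (hG 0 1).symm.dvd
    obtain ⟨r, hr⟩ := (hG 1 0).symm.dvd
    simp only [Matrix.one_apply_ne, ne_eq, zero_ne_one, one_ne_zero, not_false_eq_true,
      sub_zero] at hq hr
    have hinv := coe_inv_GL_int G
    have hdet := det_mul_self_of_GL_int G
    rw [Matrix.adjugate_fin_two] at hinv
    have hD := Matrix.det_fin_two (G : Matrix (Fin 2) (Fin 2) ℤ)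
    have hGe := Matrix.eta_fin_two (G : Matrix (Fin 2) (Fin 2) ℤ)
    generalize (G : Matrix (Fin 2) (Fin 2) ℤ).det = e at *
    generalize (G : Matrix (Fin 2) (Fin 2) ℤ) 0 0 = p at *
    generalize (G : Matrix (Fin 2) (Fin 2) ℤ) 1 1 = s at *
    rw [hq, hr] at hinv hGe hD
    refine mem_H₄set_iff.mpr ⟨e * (p * s * a + q * c * s - p * b * r - 4 * q * r * d),
      e * (-p * q * (1 + 4 * a) - 4 * q * q * c + p * p * b + p * q * (1 + 4 * d)),
      e * (r * s * (1 + 4 * a) + s * s * c - 4 * r * r * b - r * s * (1 + 4 * d)),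
      e * (-4 * q * r * a - q * c * s + p * b * r + p * s * d), ?_⟩
    rw [Units.val_mul, Units.val_mul, hinv, hGe, hA, Matrix.smul_of, Matrix.mul_fin_two]
    simp only [Matrix.smul_cons, Matrix.smul_empty, smul_eq_mul, Matrix.mul_fin_two]
    simp only [EmbeddingLike.apply_eq_iff_eq, Matrix.vecCons_inj, and_true]
    refine ⟨⟨?_, ?_⟩, ?_, ?_⟩
    · linear_combination hdet - e * hD
    · ring
    · ring
    · linear_combination hdet - e * hD
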